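/- Let AT be an argumentation theory and A an argument from AT described by the triple (G, R, p). If A is minimal, then there is no argument B from AT with B ≠ A that is also described by the same triple (G, R, p), i.e. with Prem(B) = G, Rules(B) = R and Conc(B) = p. In other words, a minimal argument is uniquely determined by its grounds, rules and conclusion. -/

import Mathlib

/-- A rule over the language `L`: a finite list of premises and a conclusion. -/
structure ArgRule (L : Type) where
  prems : List L
  concl : L

/-- An argumentation theory: a set of rules and a knowledge base. -/
structure ArgTheory (L : Type) where
  rules : Set (ArgRule L)
  kb : Set L

/-- Raw argument structures: either an element of the knowledge base, or an
application of a rule to a list of sub-arguments. -/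
inductive Arg (L : Type) : Type
  | atom (φ : L) : Arg L
  | node (children : List (Arg L)) (φ : L) : Arg L

namespace Arg

variable {L : Type}

/-- The conclusion of an argument. -/
def Conc : Arg L → L
  | .atom φ => φ
  | .node _ φ => φ

/-- The premises (grounds) of an argument. -/
def Prem : Arg L → Set L
  | .atom φ => {φ}
  | .node cs _ => cs.attach.foldr (fun c acc => Prem c.1 ∪ acc) ∅
decreasing_by have := List.sizeOf_lt_of_mem c.2; simp_wf; omega

/-- The set of rules used in an argument. -/
def Rules : Arg L → Set (ArgRule L)
  | .atom _ => ∅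
  | .node cs φ =>
      insert ⟨cs.map Conc, φ⟩ (cs.attach.foldr (fun c acc => Rules c.1 ∪ acc) ∅)
decreasing_by have := List.sizeOf_lt_of_mem c.2; simp_wf; omega

/-- The sub-arguments of an argument (including the argument itself). -/
def Sub : Arg L → Set (Arg L)
  | .atom φ => {.atom φ}
  | .node cs φ => insert (.node cs φ) (cs.attach.foldr (fun c acc => Sub c.1 ∪ acc) ∅)
decreasing_by have := List.sizeOf_lt_of_mem c.2; simp_wf; omega

/-- The top rule of an argument (undefined for atomic arguments). -/
def TopRule : Arg L → Option (ArgRule L)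
  | .atom _ => none
  | .node cs φ => some ⟨cs.map Conc, φ⟩

/-- `A.IsArg AT` holds when `A` is a genuine argument of the theory `AT`. -/
inductive IsArg (AT : ArgTheory L) : Arg L → Prop
  | atom {φ : L} : φ ∈ AT.kb → IsArg AT (.atom φ)
  | node {cs : List (Arg L)} {φ : L} :
      (∀ c ∈ cs, IsArg AT c) →
      (⟨cs.map Conc, φ⟩ : ArgRule L) ∈ AT.rules →
      IsArg AT (.node cs φ)

end Arg

/-- `Infers P R p` (written `P ⊢_R p`): `p` is in the closure of `P` under the
rules `R`, i.e. in the least set containing `P` and closed under `R`. -/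
inductive Infers (P : Set L) (R : Set (ArgRule L)) : L → Prop
  | base {p : L} : p ∈ P → Infers P R p
  | step {r : ArgRule L} : r ∈ R → (∀ q ∈ r.prems, Infers P R q) →
      Infers P R r.concl

namespace Arg

variable {L : Type}

/-- An argument `(G, R, p)` is minimal if no strict subset `G'` of `G` has
`G' ⊢_R p` and no strict subset `R'` of `R` has `G ⊢_{R'} p`. -/
def Minimal (A : Arg L) : Prop :=
  (¬ ∃ G' : Set L, G' ⊂ A.Prem ∧ Infers G' A.Rules A.Conc) ∧
  (¬ ∃ R' : Set (ArgRule L), R' ⊂ A.Rules ∧ Infers A.Prem R' A.Conc)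

/-- An argument is regular if no two distinct sub-arguments share a conclusion. -/
def Regular (A : Arg L) : Prop :=
  ¬ ∃ A₁ ∈ A.Sub, ∃ A₂ ∈ A.Sub, A₁ ≠ A₂ ∧ A₁.Conc = A₂.Conc

/-- An argument is circular if it has distinct sub-arguments with the same
conclusion, one of which is a sub-argument of the other. -/
def Circular (A : Arg L) : Prop :=
  ∃ A₁ ∈ A.Sub, ∃ A₂ ∈ A.Sub, A₁ ≠ A₂ ∧ A₁.Conc = A₂.Conc ∧ A₁ ∈ A₂.Sub

/-- An argument is redundant if it has distinct sub-arguments with the same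
conclusion, neither of which is a sub-argument of the other. -/
def Redundant (A : Arg L) : Prop :=
  ∃ A₁ ∈ A.Sub, ∃ A₂ ∈ A.Sub, A₁ ≠ A₂ ∧ A₁.Conc = A₂.Conc ∧
    A₁ ∉ A₂.Sub ∧ A₂ ∉ A₁.Sub

end Arg

namespace Infers

variable {L : Type} {P : Set L} {R R' : Set (ArgRule L)} {p q : L}

theorem trans (hR : ∀ r ∈ R, (∀ x ∈ r.prems, Infers P R' x) → Infers P R' r.concl)
    (h : Infers P R p) : Infers P R' p := by
  induction h with
  | base hp => exact .base hp
  | step hr _ ih => exact hR _ hr ih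

theorem mono (hR : R ⊆ R') (h : Infers P R p) : Infers P R' p :=
  h.trans fun _ hr hx => .step (hR hr) hx

theorem mono_grounds {P' : Set L} (hP : P ⊆ P') (h : Infers P R p) : Infers P' R p := by
  induction h with
  | base hp => exact .base (hP hp)
  | step hr _ ih => exact .step hr ih

/-- A rule whose conclusion can be inferred without it is dispensable. -/
theorem diff_singleton {r : ArgRule L} (hr : Infers P (R \ {r}) r.concl) (h : Infers P R p) :
    Infers P (R \ {r}) p := by
  refine h.trans fun s hs hx => ?_
  by_cases hsr : s = r
  · exact hsr ▸ hr
  · exact .step ⟨hs, hsr⟩ hx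

/-- An inference either avoids all rules for `q`, or contains an inference of `q` which uses a rule
for `q` only in its last step. -/
theorem avoids_or_exists_rule (q : L) (h : Infers P R p) :
    Infers P {r ∈ R | r.concl ≠ q} p ∨
      ∃ r ∈ R, r.concl = q ∧ ∀ x ∈ r.prems, Infers P {r ∈ R | r.concl ≠ q} x := by
  induction h with
  | base hp => exact .inl (.base hp)
  | @step r hr _ ih =>
    by_cases hall : ∀ x ∈ r.prems, Infers P {r ∈ R | r.concl ≠ q} x
    · by_cases hq : r.concl = q
      · exact .inr ⟨r, hr, hq, hall⟩
      · exact .inl (.step ⟨hr, hq⟩ hall)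
    · push Not at hall
      obtain ⟨x, hx, hnx⟩ := hall
      exact .inr ((ih x hx).resolve_left hnx)

/-- Of two distinct rules with the same inferable conclusion, one is dispensable for it. -/
theorem diff_singleton_or {r s : ArgRule L} (hrs : r ≠ s) (hc : r.concl = s.concl)
    (h : Infers P R r.concl) :
    Infers P (R \ {r}) r.concl ∨ Infers P (R \ {s}) s.concl := by
  have avoid : ∀ t : ArgRule L, t.concl = r.concl →
      {u ∈ R | u.concl ≠ r.concl} ⊆ R \ {t} := by
    rintro t ht u ⟨hu, hne⟩
    exact ⟨hu, fun hut => hne (hut ▸ ht)⟩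
  rcases h.avoids_or_exists_rule r.concl with h | ⟨t, ht, htc, hx⟩
  · exact .inl (h.mono (avoid r rfl))
  · by_cases htr : t = r
    · refine .inr ?_
      rw [← hc, ← htc]
      exact .step ⟨ht, fun hts => hrs (htr.symm.trans hts)⟩
        fun x hxt => (hx x hxt).mono (avoid s hc.symm)
    · refine .inl ?_
      rw [← htc]
      exact .step ⟨ht, htr⟩ fun x hxt => (hx x hxt).mono (htc ▸ avoid r rfl)

end Infers

namespace Arg

variable {L : Type} {AT : ArgTheory L}

theorem mem_foldr_union {α β : Type*} {f : α → Set β} {l : List α} {x : β} :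
    x ∈ l.foldr (fun c acc => f c ∪ acc) ∅ ↔ ∃ c ∈ l, x ∈ f c := by
  induction l with
  | nil => simp
  | cons a l ih => simp [ih]

theorem mem_prem_node {cs : List (Arg L)} {φ x : L} :
    x ∈ (node cs φ).Prem ↔ ∃ c ∈ cs, x ∈ c.Prem := by
  rw [Prem, mem_foldr_union]
  simp

theorem mem_rules_node {cs : List (Arg L)} {φ : L} {r : ArgRule L} :
    r ∈ (node cs φ).Rules ↔ r = ⟨cs.map Conc, φ⟩ ∨ ∃ c ∈ cs, r ∈ c.Rules := by
  rw [Rules, Set.mem_insert_iff, mem_foldr_union]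
  simp

theorem infers_conc {A : Arg L} (hA : A.IsArg AT) : Infers A.Prem A.Rules A.Conc := by
  induction hA with
  | @atom φ _ =>
    rw [Prem]
    exact .base rfl
  | @node cs φ _ _ ih =>
    refine Infers.step (r := ⟨cs.map Conc, φ⟩) (mem_rules_node.2 (.inl rfl)) fun q hq => ?_
    obtain ⟨c, hc, rfl⟩ := List.mem_map.1 hq
    exact ((ih c hc).mono fun r hr => mem_rules_node.2 (.inr ⟨c, hc, hr⟩)).mono_grounds
      fun x hx => mem_prem_node.2 ⟨c, hc, hx⟩

/-- The conclusion of every rule used in an argument is inferable from its grounds and rules. -/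
theorem infers_concl_of_mem_rules {A : Arg L} (hA : A.IsArg AT) {r : ArgRule L}
    (hr : r ∈ A.Rules) : Infers A.Prem A.Rules r.concl := by
  induction hA with
  | atom => simp [Rules] at hr
  | @node cs φ hcs hrule ih =>
    rcases mem_rules_node.1 hr with rfl | ⟨c, hc, hrc⟩
    · exact infers_conc (.node hcs hrule)
    · exact ((ih c hc hrc).mono fun r hr => mem_rules_node.2 (.inr ⟨c, hc, hr⟩)).mono_grounds
        fun x hx => mem_prem_node.2 ⟨c, hc, hx⟩

theorem Minimal.not_infers_diff_singleton {A : Arg L} (hmin : A.Minimal) (hA : A.IsArg AT)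
    {r : ArgRule L} (hr : r ∈ A.Rules) : ¬ Infers A.Prem (A.Rules \ {r}) r.concl := fun h =>
  hmin.2 ⟨A.Rules \ {r}, Set.sdiff_singleton_ssubset.2 hr, h.diff_singleton (infers_conc hA)⟩

theorem Minimal.concl_notMem_prem {A : Arg L} (hmin : A.Minimal) (hA : A.IsArg AT)
    {r : ArgRule L} (hr : r ∈ A.Rules) : r.concl ∉ A.Prem := fun h =>
  hmin.not_infers_diff_singleton hA hr (.base h)

theorem Minimal.injOn_concl {A : Arg L} (hmin : A.Minimal) (hA : A.IsArg AT) :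
    Set.InjOn ArgRule.concl A.Rules := by
  intro r hr s hs hc
  by_contra hrs
  rcases (infers_concl_of_mem_rules hA hr).diff_singleton_or hrs hc with h | h
  · exact hmin.not_infers_diff_singleton hA hr h
  · exact hmin.not_infers_diff_singleton hA hs h

/-- If no two rules share a conclusion and no rule concludes a ground, then arguments are
determined by their conclusions. -/
theorem eq_of_conc_eq {G : Set L} {R : Set (ArgRule L)} (hG : ∀ r ∈ R, r.concl ∉ G)
    (hR : Set.InjOn ArgRule.concl R) {A : Arg L} (hA : A.IsArg AT) {B : Arg L}
    (hAG : A.Prem ⊆ G) (hAR : A.Rules ⊆ R) (hBG : B.Prem ⊆ G) (hBR : B.Rules ⊆ R)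
    (h : A.Conc = B.Conc) : A = B := by
  induction hA generalizing B with
  | @atom φ _ =>
    cases B with
    | atom ψ => exact congrArg atom h
    | node ds ψ =>
      obtain rfl : φ = ψ := h
      exact absurd (hAG (by simp [Prem])) (hG _ (hBR (mem_rules_node.2 (.inl rfl))))
  | @node cs φ _ _ ih =>
    cases B with
    | atom ψ =>
      obtain rfl : φ = ψ := h
      exact absurd (hBG (by simp [Prem])) (hG _ (hAR (mem_rules_node.2 (.inl rfl))))
    | node ds ψ =>
      obtain rfl : φ = ψ := h
      have hrule := hR (hAR (mem_rules_node.2 (.inl rfl))) (hBR (mem_rules_node.2 (.inl rfl))) rfl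
      have hmap : cs.map Conc = ds.map Conc := congrArg ArgRule.prems hrule
      have hlen : cs.length = ds.length := by simpa using congrArg List.length hmap
      congr 1
      refine List.ext_getElem hlen fun i hi hj => ?_
      have hc := List.getElem_mem hi
      have hd := List.getElem_mem hj
      refine ih _ hc (fun x hx => hAG (mem_prem_node.2 ⟨_, hc, hx⟩))
        (fun r hr => hAR (mem_rules_node.2 (.inr ⟨_, hc, hr⟩)))
        (fun x hx => hBG (mem_prem_node.2 ⟨_, hd, hx⟩))
        (fun r hr => hBR (mem_rules_node.2 (.inr ⟨_, hd, hr⟩))) ?_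
      have := List.getElem_of_eq hmap (by simpa using hi : i < (cs.map Conc).length)
      simpa using this

end Arg

/-- A minimal argument is uniquely determined by its grounds, rules and
conclusion: no other argument of the theory has the same description. -/
theorem stmt_3 {L : Type} (AT : ArgTheory L) (A : Arg L) (hA : A.IsArg AT)
    (hmin : A.Minimal) :
    ¬ ∃ B : Arg L, B.IsArg AT ∧ B ≠ A ∧
      B.Prem = A.Prem ∧ B.Rules = A.Rules ∧ B.Conc = A.Conc := by
  rintro ⟨B, hB, hne, hprem, hrules, hconc⟩
  exact hne (Arg.eq_of_conc_eq (fun _ hr => hmin.concl_notMem_prem hA hr) (hmin.injOn_concl hA) hB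
    hprem.subset hrules.subset subset_rfl subset_rfl hconc)
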